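/- arXiv:2310.12693 — 2 statements merged into one kernel-verified Lean document; each statement's English description precedes it below -/
import Mathlib

section
/- Let N ≥ 2 be a natural number, let x be an integer, let t be a natural number, and let u = x^(2^t) mod N and y = x^(2^(2t)) mod N. Then for every natural number r, (x^r · u)^(2^t) ≡ u^r · y (mod N). (Completeness of one halving step of Pietrzak's proof: if u is the honest midpoint and y the honest output for time 2t, then the updated pair x' = x^r·u, y' = u^r·y satisfies y' ≡ x'^(2^t) (mod N), i.e., it is a correct instance for time t.) -/
/-- Completeness of one halving step of Pietrzak's proof: if `u = x ^ (2 ^ t) % N`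
is the honest midpoint and `y = x ^ (2 ^ (2 * t)) % N` the honest output for time
`2 * t`, then for every challenge `r`, `(x ^ r * u) ^ (2 ^ t) ≡ u ^ r * y (mod N)`. -/
theorem pietrzak_halving_complete (N : ℕ) (hN : 2 ≤ N) (x : ℤ) (t : ℕ)
    (u y : ℤ) (hu : u = x ^ (2 ^ t) % (N : ℤ)) (hy : y = x ^ (2 ^ (2 * t)) % (N : ℤ))
    (r : ℕ) :
    (x ^ r * u) ^ (2 ^ t) ≡ u ^ r * y [ZMOD (N : ℤ)] := by
  have hu' : u ≡ x ^ (2 ^ t) [ZMOD (N : ℤ)] := hu ▸ Int.mod_modEq _ _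
  have hy' : y ≡ x ^ (2 ^ (2 * t)) [ZMOD (N : ℤ)] := hy ▸ Int.mod_modEq _ _
  have huy : u ^ (2 ^ t) ≡ y [ZMOD (N : ℤ)] := by
    refine (hu'.pow (2 ^ t)).trans ?_
    rw [← pow_mul, ← pow_add, ← two_mul]
    exact hy'.symm
  rw [mul_pow, pow_right_comm]
  exact (hu'.symm.pow r).mul huy
end

section
/- Let N ≥ 2 be a natural number, x an integer, k a natural number, and let (r₀, …, r_{k−1}) be any sequence of natural numbers (the verifier's challenges). Define sequences recursively: x₀ = x mod N and y₀ = x^(2^(2^k)) mod N, and for each i < k set u_i = x_i^(2^(2^(k−1−i))) mod N, x_{i+1} = x_i^{r_i} · u_i mod N, and y_{i+1} = u_i^{r_i} · y_i mod N. Then the final pair satisfies y_k ≡ x_k² (mod N). (Full completeness of Pietrzak's recursive proof for time parameter T = 2^k: after k honest halving steps the verifier's base-case check y = x² mod N succeeds.) -/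
/-- One honest halving step: if `y` is congruent to `x ^ (e * e)` and the midpoint `u` to `x ^ e`,
then the folded instance satisfies the relation with exponent `e`. -/
theorem Int.ModEq.halving_step {n x y u : ℤ} {e : ℕ} (r : ℕ)
    (hy : y ≡ x ^ (e * e) [ZMOD n]) (hu : u ≡ x ^ e [ZMOD n]) :
    u ^ r * y ≡ (x ^ r * u) ^ e [ZMOD n] :=
  calc u ^ r * y ≡ (x ^ e) ^ r * x ^ (e * e) [ZMOD n] := (hu.pow r).mul hy
    _ = (x ^ r) ^ e * (x ^ e) ^ e := by rw [pow_mul, pow_right_comm x e r]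
    _ ≡ (x ^ r) ^ e * u ^ e [ZMOD n] := (hu.symm.pow e).mul_left _
    _ = (x ^ r * u) ^ e := (mul_pow _ _ _).symm

/-- Full completeness of Pietrzak's recursive proof for time parameter `T = 2 ^ k`:
starting from `x₀ = x % N`, `y₀ = x ^ (2 ^ (2 ^ k)) % N`, with honest midpoints
`uᵢ = xᵢ ^ (2 ^ (2 ^ (k - 1 - i))) % N` and arbitrary challenges `rᵢ`, after `k`
halving steps the verifier's base-case check `y_k ≡ x_k ^ 2 (mod N)` succeeds. -/
theorem pietrzak_recursive_complete (N : ℕ) (hN : 2 ≤ N) (x : ℤ) (k : ℕ)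
    (r : ℕ → ℕ) (xs ys us : ℕ → ℤ)
    (hx0 : xs 0 = x % (N : ℤ))
    (hy0 : ys 0 = x ^ (2 ^ (2 ^ k)) % (N : ℤ))
    (hus : ∀ i < k, us i = (xs i) ^ (2 ^ (2 ^ (k - 1 - i))) % (N : ℤ))
    (hxs : ∀ i < k, xs (i + 1) = (xs i) ^ (r i) * us i % (N : ℤ))
    (hys : ∀ i < k, ys (i + 1) = (us i) ^ (r i) * ys i % (N : ℤ)) :
    ys k ≡ (xs k) ^ 2 [ZMOD (N : ℤ)] := by
  have invariant : ∀ i ≤ k, ys i ≡ xs i ^ (2 ^ (2 ^ (k - i))) [ZMOD (N : ℤ)] := by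
    intro i
    induction i with
    | zero =>
      intro _
      rw [hx0, hy0]
      exact (Int.mod_modEq _ _).trans ((Int.mod_modEq x N).symm.pow _)
    | succ i ih =>
      intro hi
      have hy := ih (by lia)
      have hu : us i ≡ xs i ^ (2 ^ (2 ^ (k - (i + 1)))) [ZMOD (N : ℤ)] := by
        rw [hus i hi, show k - 1 - i = k - (i + 1) by lia]
        exact Int.mod_modEq _ _
      rw [show k - i = k - (i + 1) + 1 by lia, pow_succ 2 (k - (i + 1)), mul_two, pow_add] at hy
      rw [hys i hi, hxs i hi]
      exact (Int.mod_modEq _ _).trans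
        ((hy.halving_step (r i) hu).trans ((Int.mod_modEq _ _).symm.pow _))
  simpa using invariant k le_rfl
end
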